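/- Let Ω ⊂ ℝⁿ be a bounded John domain (n ≥ 3) with extended Whitney cubes {Ω_t}_{t∈Γ} and a tree structure on Γ with root a and geometric constant K (Q_s ⊆ K Q_t for s ⪰ t). Let g ∈ L¹(Ω, ℝ^{n×n}) satisfy ∫_Ω g:φ = 0 for all φ ∈ V, and suppose supp(g) ∩ Ω_s ≠ ∅ only for finitely many s ∈ Γ. Then there exists a collection {g_t}_{t∈Γ} in L¹(Ω, ℝ^{n×n}) such that: (1) g = Σ_{t∈Γ} g_t; (2) supp(g_t) ⊂ Ω_t; (3) ∫_{Ω_t} g_t:φ = 0 for all φ ∈ V and all t. Moreover, for each t ∈ Γ: if x ∈ B_s where s = t or the parent of s is t, then ‖g_t‖_∞(x) ≤ ‖g‖_∞(x) + C_n K^{n+1} T‖g‖₁(x) with C_n depending only on n; otherwise (x ∉ ∪_s B_s, or x ∈ B_s with s ≠ t and parent of s ≠ t), ‖g_t‖_∞(x) ≤ ‖g‖_∞(x). Finally, g_t ≡ 0 for all t outside the finite subtree Γ_g := {s ∈ Γ : there is k ⪰ s with supp(g) ∩ Ω_k ≠ ∅}. -/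

import Mathlib

open MeasureTheory Metric Set Matrix
open scoped BigOperators ENNReal

noncomputable section

abbrev Euc (n : ℕ) := EuclideanSpace ℝ (Fin n)

/-- Differential matrix `(Dv)_{ij} = ∂v_i/∂x_j` (computed via the Fréchet derivative). -/
def Dmat {n : ℕ} (v : Euc n → Euc n) (x : Euc n) : Matrix (Fin n) (Fin n) ℝ :=
  fun i j => fderiv ℝ v x (EuclideanSpace.single j 1) i

/-- Symmetric part of the differential matrix. -/
def epsMat {n : ℕ} (v : Euc n → Euc n) (x : Euc n) : Matrix (Fin n) (Fin n) ℝ :=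
  (1 / 2 : ℝ) • (Dmat v x + (Dmat v x)ᵀ)

/-- Trace-free part of the symmetric part of the differential matrix. -/
def lMat {n : ℕ} (v : Euc n → Euc n) (x : Euc n) : Matrix (Fin n) (Fin n) ℝ :=
  epsMat v x - (Matrix.trace (Dmat v x) / (n : ℝ)) • (1 : Matrix (Fin n) (Fin n) ℝ)

/-- Frobenius (Euclidean) norm of a matrix. -/
def matNorm {n : ℕ} (M : Matrix (Fin n) (Fin n) ℝ) : ℝ :=
  Real.sqrt (∑ i, ∑ j, (M i j) ^ 2)

/-- `M : N = Σ_{ij} M_{ij} N_{ij}`. -/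
def matDot {n : ℕ} (M N : Matrix (Fin n) (Fin n) ℝ) : ℝ := ∑ i, ∑ j, M i j * N i j

/-- Distance to the boundary of `Ω`. -/
def distBd {n : ℕ} (Ω : Set (Euc n)) (x : Euc n) : ℝ := Metric.infDist x (frontier Ω)

/-- Open axis-parallel cube with center `c` and side length `h`. -/
def openCube {n : ℕ} (c : Euc n) (h : ℝ) : Set (Euc n) := {x | ∀ i, |x i - c i| < h / 2}

/-- Closed axis-parallel cube with center `c` and side length `h`. -/
def closedCube {n : ℕ} (c : Euc n) (h : ℝ) : Set (Euc n) := {x | ∀ i, |x i - c i| ≤ h / 2}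

/-- Bounded John domain: there are `C > 1` and a distinguished point `x₀ ∈ Ω` such that
every point of `Ω` is joined to `x₀` by a rectifiable curve, parameterized by arc length
(hence 1-Lipschitz), along which the distance to the boundary grows linearly. -/
def IsJohnDomain {n : ℕ} (Ω : Set (Euc n)) : Prop :=
  ∃ C > (1 : ℝ), ∃ x₀ ∈ Ω, ∀ y ∈ Ω, ∃ L : ℝ, 0 ≤ L ∧ ∃ γ : ℝ → Euc n,
    γ 0 = y ∧ γ L = x₀ ∧ (∀ t ∈ Icc 0 L, γ t ∈ Ω) ∧
    (∀ s ∈ Icc 0 L, ∀ t ∈ Icc 0 L, dist (γ s) (γ t) ≤ |s - t|) ∧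
    (∀ t ∈ Icc 0 L, t / C ≤ Metric.infDist (γ t) (frontier Ω))

/-- The matrix-valued functions `H_i`. -/
def Hmat {n : ℕ} (i : Fin n) (z : Euc n) : Matrix (Fin n) (Fin n) ℝ :=
  fun j k => if j = k then z i else if k = i then z j else if j = i then -z k else 0

/-- The finite-dimensional space `V = D(Σ)`:
`φ(x) = A + λ I + Σ_i b_i H_i(x − y)` with `A` skew-symmetric. -/
def Vset (n : ℕ) : Set (Euc n → Matrix (Fin n) (Fin n) ℝ) :=
  {φ | ∃ (A : Matrix (Fin n) (Fin n) ℝ) (lam : ℝ) (b : Fin n → ℝ) (y : Euc n),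
    Aᵀ = -A ∧ ∀ x, φ x = A + lam • (1 : Matrix (Fin n) (Fin n) ℝ) + ∑ i, b i • Hmat i (x - y)}


/-- A Whitney decomposition of `Ω`: closed dyadic axis-parallel cubes `Q_t` with pairwise
disjoint interiors covering `Ω`, with `diam(Q_t) ≤ dist(Q_t, ∂Ω) ≤ 4 diam(Q_t)` and
comparable diameters (within a factor 4) for touching cubes. -/
structure WhitneyDecomp (n : ℕ) (Ω : Set (Euc n)) (Γ : Type) where
  c : Γ → Euc n
  s : Γ → ℝ
  s_pos : ∀ t, 0 < s t
  dyadic : ∀ t, ∃ k : ℤ, s t = (2 : ℝ) ^ k ∧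
    ∀ i, ∃ m : ℤ, c t i = (m : ℝ) * (2 : ℝ) ^ k + (2 : ℝ) ^ k / 2
  interior_disj : Pairwise fun t t' =>
    interior (closedCube (c t) (s t)) ∩ interior (closedCube (c t') (s t')) = ∅
  cover : (⋃ t, closedCube (c t) (s t)) = Ω
  diam_le_dist : ∀ t, ∀ x ∈ closedCube (c t) (s t),
    Metric.diam (closedCube (c t) (s t)) ≤ Metric.infDist x (frontier Ω)
  dist_le_diam : ∀ t, ∃ x ∈ closedCube (c t) (s t),
    Metric.infDist x (frontier Ω) ≤ 4 * Metric.diam (closedCube (c t) (s t))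
  nbr_comparable : ∀ t t', (closedCube (c t) (s t) ∩ closedCube (c t') (s t')).Nonempty →
    Metric.diam (closedCube (c t) (s t)) ≤ 4 * Metric.diam (closedCube (c t') (s t'))

/-- The extended (open) Whitney cube `Ω_t = (9/8) Q_t°`. -/
def extCube {n : ℕ} {Ω : Set (Euc n)} {Γ : Type} (wd : WhitneyDecomp n Ω Γ) (t : Γ) :
    Set (Euc n) :=
  openCube (wd.c t) (9 / 8 * wd.s t)

/-- A closed `(n−1)`-dimensional face of the cube with center `c` and side `h`. -/
def cubeFace {n : ℕ} (c : Euc n) (h : ℝ) (i : Fin n) (σ : Bool) : Set (Euc n) :=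
  {x ∈ closedCube c h | x i = c i + (if σ then h / 2 else -(h / 2))}

/-- Two axis-parallel cubes are `(n−1)`-neighbors when their intersection is an
`(n−1)`-dimensional face of one of them. -/
def IsFaceNeighbor {n : ℕ} (c₁ : Euc n) (h₁ : ℝ) (c₂ : Euc n) (h₂ : ℝ) : Prop :=
  ∃ i σ, closedCube c₁ h₁ ∩ closedCube c₂ h₂ = cubeFace c₁ h₁ i σ ∨
    closedCube c₁ h₁ ∩ closedCube c₂ h₂ = cubeFace c₂ h₂ i σ

/-- A tree structure on the index set `Γ` of a Whitney decomposition: a root and a parent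
map reaching the root in finitely many steps, whose edges join `(n−1)`-neighbor cubes. -/
structure TreeStruct {n : ℕ} {Ω : Set (Euc n)} {Γ : Type} (wd : WhitneyDecomp n Ω Γ) where
  root : Γ
  parent : Γ → Γ
  parent_root : parent root = root
  reaches_root : ∀ t, ∃ k : ℕ, parent^[k] t = root
  parent_nbr : ∀ t, t ≠ root →
    IsFaceNeighbor (wd.c t) (wd.s t) (wd.c (parent t)) (wd.s (parent t))

/-- The induced partial order: `s ⪯ t` iff the path from `t` to the root passes
through `s`, i.e. `s` is obtained from `t` by iterating the parent map. -/
def treeLE {n : ℕ} {Ω : Set (Euc n)} {Γ : Type} {wd : WhitneyDecomp n Ω Γ}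
    (T : TreeStruct wd) (s t : Γ) : Prop :=
  ∃ k : ℕ, T.parent^[k] t = s

/-- The shadow `W_t = ⋃_{s ⪰ t} Ω_s` of the extended cube `Ω_t`. -/
def shadow {n : ℕ} {Ω : Set (Euc n)} {Γ : Type} {wd : WhitneyDecomp n Ω Γ}
    (T : TreeStruct wd) (t : Γ) : Set (Euc n) :=
  ⋃ (s : Γ) (_ : treeLE T t s), extCube wd s

open Classical in
/-- The Hardy type operator `Tg(x) = Σ_{t ≠ a} (χ_{B_t}(x)/|W_t|) ∫_{W_t} |g|`, for a
family of cubes `B_t = openCube (Bc t) (Bh t)`. -/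
def hardyT {n : ℕ} {Ω : Set (Euc n)} {Γ : Type} {wd : WhitneyDecomp n Ω Γ}
    (T : TreeStruct wd) (Bc : Γ → Euc n) (Bh : Γ → ℝ) (u : Euc n → ℝ) (x : Euc n) : ℝ :=
  ∑ᶠ t : Γ, if t = T.root then 0 else
    Set.indicator (openCube (Bc t) (Bh t))
      (fun _ => (∫ y in shadow T t, |u y|) / (volume (shadow T t)).toReal) x

/-- `‖M‖₁ = Σ_{ij} |M_{ij}|`. -/
def matL1 {n : ℕ} (M : Matrix (Fin n) (Fin n) ℝ) : ℝ := ∑ i, ∑ j, |M i j|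

/-- `‖M‖_∞ = max_{ij} |M_{ij}|`. -/
def matLinf {n : ℕ} (M : Matrix (Fin n) (Fin n) ℝ) : ℝ := ⨆ i, ⨆ j, |M i j|

/-- The finite subtree `Γ_g` of indices below some cube meeting the support of `g`. -/
def subtreeOf {n : ℕ} {Ω : Set (Euc n)} {Γ : Type} {wd : WhitneyDecomp n Ω Γ}
    (T : TreeStruct wd) (g : Euc n → Matrix (Fin n) (Fin n) ℝ) : Set Γ :=
  {s : Γ | ∃ k : Γ, treeLE T s k ∧ (Function.support g ∩ extCube wd k).Nonempty}

section CubeGeometry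

variable {n : ℕ} {c : Euc n} {h : ℝ}

theorem openCube_eq_preimage (c : Euc n) (h : ℝ) :
    openCube c h =
      (WithLp.ofLp : Euc n → (Fin n → ℝ)) ⁻¹'
        Set.pi univ fun i => Ioo (c i - h / 2) (c i + h / 2) := by
  ext x
  simp only [openCube, mem_ofPred_eq, mem_preimage, Set.mem_pi, mem_univ, true_implies, mem_Ioo,
    abs_lt]
  exact forall_congr' fun i => ⟨fun H => ⟨by linarith, by linarith⟩,
    fun H => ⟨by linarith, by linarith⟩⟩

theorem isOpen_openCube (c : Euc n) (h : ℝ) : IsOpen (openCube c h) := by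
  rw [openCube_eq_preimage]
  exact (isOpen_set_pi finite_univ fun i _ => isOpen_Ioo).preimage (by fun_prop)

theorem measurableSet_openCube (c : Euc n) (h : ℝ) : MeasurableSet (openCube c h) :=
  (isOpen_openCube c h).measurableSet

theorem self_mem_openCube (c : Euc n) (hh : 0 < h) : c ∈ openCube c h := fun i => by
  simpa using half_pos hh

theorem volume_openCube (c : Euc n) (hh : 0 ≤ h) :
    volume (openCube c h) = ENNReal.ofReal (h ^ n) := by
  rw [openCube_eq_preimage, (PiLp.volume_preserving_ofLp (Fin n)).measure_preimage
    (MeasurableSet.univ_pi fun i => measurableSet_Ioo).nullMeasurableSet, Real.volume_pi_Ioo]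
  simp [show ∀ i, c i + h / 2 - (c i - h / 2) = h from fun i => by ring,
    ENNReal.ofReal_pow hh]

theorem closedCube_subset_closedBall (c : Euc n) (h : ℝ) :
    closedCube c h ⊆ closedBall c (∑ _i : Fin n, |h / 2|) := by
  intro x hx
  rw [mem_closedBall, dist_eq_norm, EuclideanSpace.norm_eq]
  refine Real.sqrt_le_iff.2 ⟨by positivity, ?_⟩
  refine le_trans ?_ (Finset.sum_sq_le_sq_sum_of_nonneg fun i _ => abs_nonneg (h / 2))
  refine Finset.sum_le_sum fun i _ => ?_
  rw [Real.norm_eq_abs]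
  exact pow_le_pow_left₀ (abs_nonneg _) ((hx i).trans (le_abs_self _)) 2

theorem openCube_subset_closedCube (c : Euc n) (h : ℝ) : openCube c h ⊆ closedCube c h :=
  fun _ hx i => (hx i).le

theorem isBounded_closedCube (c : Euc n) (h : ℝ) : Bornology.IsBounded (closedCube c h) :=
  isBounded_closedBall.subset (closedCube_subset_closedBall c h)

theorem isBounded_openCube (c : Euc n) (h : ℝ) : Bornology.IsBounded (openCube c h) :=
  (isBounded_closedCube c h).subset (openCube_subset_closedCube c h)

theorem Continuous.integrableOn_openCube {f : Euc n → ℝ} (hf : Continuous f) (c : Euc n)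
    (h : ℝ) : IntegrableOn f (openCube c h) :=
  (hf.locallyIntegrable.integrableOn_isCompact (isBounded_openCube c h).isCompact_closure).mono_set
    subset_closure

theorem setIntegral_openCube_prod (c : Euc n) (h : ℝ) (p : Fin n → ℝ → ℝ) :
    ∫ x in openCube c h, ∏ k, p k (x k - c k) =
      ∏ k, ∫ u in Ioo (-(h / 2)) (h / 2), p k u := by
  rw [openCube_eq_preimage, (PiLp.volume_preserving_ofLp (Fin n)).setIntegral_preimage_emb
    (MeasurableEquiv.toLp 2 (Fin n → ℝ)).symm.measurableEmbedding
    (fun y => ∏ k, p k (y k - c k)), volume_pi, Measure.restrict_pi_pi,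
    integral_fintype_prod_eq_prod (fun k u => p k (u - c k))]
  refine Finset.prod_congr rfl fun k _ => ?_
  have := (measurePreserving_sub_right volume (c k)).setIntegral_preimage_emb
    (MeasurableEquiv.subRight (c k)).measurableEmbedding (p k) (Ioo (-(h / 2)) (h / 2))
  rw [← this]
  congr 2
  ext u
  simp only [mem_Ioo, mem_preimage]
  constructor <;> rintro ⟨h1, h2⟩ <;> constructor <;> linarith

theorem setIntegral_Ioo_symm_id (r : ℝ) (hr : 0 ≤ r) : ∫ u in Ioo (-r) r, u = 0 := by
  rw [← integral_Ioc_eq_integral_Ioo, ← intervalIntegral.integral_of_le (by linarith),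
    integral_id]
  ring

theorem setIntegral_Ioo_symm_sq (r : ℝ) (hr : 0 ≤ r) :
    ∫ u in Ioo (-r) r, u * u = 2 * r ^ 3 / 3 := by
  rw [← integral_Ioc_eq_integral_Ioo, ← intervalIntegral.integral_of_le (by linarith)]
  simp_rw [← sq]
  rw [integral_pow]
  norm_num
  ring

theorem setIntegral_openCube_coord (c : Euc n) (hh : 0 ≤ h) (i : Fin n) :
    ∫ x in openCube c h, (x i - c i) = 0 := by
  have := setIntegral_openCube_prod c h fun k u => if k = i then u else 1
  simp only [Finset.prod_ite_eq', Finset.mem_univ, if_true] at this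
  rw [this]
  refine Finset.prod_eq_zero (Finset.mem_univ i) ?_
  simpa using setIntegral_Ioo_symm_id (h / 2) (by positivity)

theorem setIntegral_openCube_coord_mul (c : Euc n) (hh : 0 < h) (i j : Fin n) :
    ∫ x in openCube c h, (x i - c i) * (x j - c j) = if i = j then h ^ n * (h ^ 2 / 12) else 0 := by
  have := setIntegral_openCube_prod c h
    fun k u => (if k = i then u else 1) * (if k = j then u else 1)
  simp only [Finset.prod_mul_distrib, Finset.prod_ite_eq', Finset.mem_univ, if_true] at this
  rw [this]
  split_ifs with hij
  · subst hij
    rw [← Finset.mul_prod_erase _ _ (Finset.mem_univ i)]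
    have h1 : ∀ k ∈ Finset.univ.erase i, (∫ u in Ioo (-(h / 2)) (h / 2),
        (if k = i then u else 1) * (if k = i then u else 1)) = h := by
      intro k hk
      simp [Finset.ne_of_mem_erase hk, hh.le]
    rw [Finset.prod_congr rfl h1]
    simp only [if_true, setIntegral_Ioo_symm_sq (h / 2) (by positivity), Finset.prod_const,
      Finset.card_erase_of_mem (Finset.mem_univ i), Finset.card_univ, Fintype.card_fin]
    have : h ^ n = h ^ (n - 1) * h := by
      rw [← pow_succ, Nat.sub_add_cancel (Nat.one_le_of_lt i.2)]
    rw [this]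
    ring
  · refine Finset.prod_eq_zero (Finset.mem_univ i) ?_
    simpa [hij] using setIntegral_Ioo_symm_id (h / 2) (by positivity)

end CubeGeometry

section MatDot

variable {n : ℕ}

theorem matDot_add_left (M M' N : Matrix (Fin n) (Fin n) ℝ) :
    matDot (M + M') N = matDot M N + matDot M' N := by
  simp [matDot, add_mul, Finset.sum_add_distrib]

theorem matDot_sub_left (M M' N : Matrix (Fin n) (Fin n) ℝ) :
    matDot (M - M') N = matDot M N - matDot M' N := by
  simp [matDot, sub_mul, Finset.sum_sub_distrib]

theorem matDot_add_right (M N N' : Matrix (Fin n) (Fin n) ℝ) :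
    matDot M (N + N') = matDot M N + matDot M N' := by
  simp [matDot, mul_add, Finset.sum_add_distrib]

theorem matDot_smul_left (r : ℝ) (M N : Matrix (Fin n) (Fin n) ℝ) :
    matDot (r • M) N = r * matDot M N := by
  simp [matDot, Finset.mul_sum, mul_assoc]

theorem matDot_smul_right (r : ℝ) (M N : Matrix (Fin n) (Fin n) ℝ) :
    matDot M (r • N) = r * matDot M N := by
  simp [matDot, Finset.mul_sum, mul_left_comm]

@[simp] theorem matDot_zero_left (N : Matrix (Fin n) (Fin n) ℝ) : matDot 0 N = 0 := by
  simp [matDot]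

@[simp] theorem matDot_zero_right (M : Matrix (Fin n) (Fin n) ℝ) : matDot M 0 = 0 := by
  simp [matDot]

theorem matDot_sum_left {ι : Type*} (s : Finset ι) (M : ι → Matrix (Fin n) (Fin n) ℝ)
    (N : Matrix (Fin n) (Fin n) ℝ) : matDot (∑ i ∈ s, M i) N = ∑ i ∈ s, matDot (M i) N := by
  classical
  induction s using Finset.induction_on with
  | empty => simp
  | insert a s ha ih => simp [Finset.sum_insert ha, matDot_add_left, ih]

theorem matDot_sum_right {ι : Type*} (s : Finset ι) (M : Matrix (Fin n) (Fin n) ℝ)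
    (N : ι → Matrix (Fin n) (Fin n) ℝ) : matDot M (∑ i ∈ s, N i) = ∑ i ∈ s, matDot M (N i) := by
  classical
  induction s using Finset.induction_on with
  | empty => simp
  | insert a s ha ih => simp [Finset.sum_insert ha, matDot_add_right, ih]

theorem matDot_single_left (i : Fin n) (N : Matrix (Fin n) (Fin n) ℝ) :
    matDot (Matrix.single i i 1) N = N i i := by
  simp [matDot, Matrix.single_apply, ite_and]

theorem matL1_nonneg (M : Matrix (Fin n) (Fin n) ℝ) : 0 ≤ matL1 M :=
  Finset.sum_nonneg fun _ _ => Finset.sum_nonneg fun _ _ => abs_nonneg _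

theorem abs_apply_le_matL1 (M : Matrix (Fin n) (Fin n) ℝ) (j k : Fin n) : |M j k| ≤ matL1 M :=
  (Finset.single_le_sum (f := fun k => |M j k|) (fun _ _ => abs_nonneg _)
    (Finset.mem_univ k)).trans
    (Finset.single_le_sum (f := fun j => ∑ k, |M j k|)
      (fun _ _ => Finset.sum_nonneg fun _ _ => abs_nonneg _) (Finset.mem_univ j))

theorem abs_matDot_le {M N : Matrix (Fin n) (Fin n) ℝ} {C : ℝ} (hN : ∀ j k, |N j k| ≤ C) :
    |matDot M N| ≤ matL1 M * C := by
  unfold matDot matL1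
  rw [Finset.sum_mul]
  refine (Finset.abs_sum_le_sum_abs _ _).trans (Finset.sum_le_sum fun j _ => ?_)
  rw [Finset.sum_mul]
  refine (Finset.abs_sum_le_sum_abs _ _).trans (Finset.sum_le_sum fun k _ => ?_)
  rw [abs_mul]
  exact mul_le_mul_of_nonneg_left (hN j k) (abs_nonneg _)

theorem abs_apply_le_matLinf (M : Matrix (Fin n) (Fin n) ℝ) (j k : Fin n) :
    |M j k| ≤ matLinf M :=
  (le_ciSup (f := fun k => |M j k|) (Finite.bddAbove_range _) k).trans
    (le_ciSup (f := fun j => ⨆ k, |M j k|) (Finite.bddAbove_range _) j)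

theorem matLinf_le {M : Matrix (Fin n) (Fin n) ℝ} {C : ℝ} (hC : 0 ≤ C)
    (hM : ∀ j k, |M j k| ≤ C) : matLinf M ≤ C :=
  Real.iSup_le (fun j => Real.iSup_le (fun k => hM j k) hC) hC

theorem matLinf_nonneg (M : Matrix (Fin n) (Fin n) ℝ) : 0 ≤ matLinf M :=
  Real.iSup_nonneg fun _ => Real.iSup_nonneg fun _ => abs_nonneg _

end MatDot

section VSpace

variable {n : ℕ}

theorem Hmat_add (i : Fin n) (z w : Euc n) : Hmat i (z + w) = Hmat i z + Hmat i w := by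
  ext j k
  simp only [Hmat, Matrix.add_apply, PiLp.add_apply]
  split_ifs <;> ring

theorem Hmat_self (i j : Fin n) (z : Euc n) : Hmat i z j j = z i := by simp [Hmat]

theorem continuous_Hmat (i : Fin n) : Continuous (Hmat i : Euc n → Matrix (Fin n) (Fin n) ℝ) := by
  refine continuous_matrix fun j k => ?_
  unfold Hmat
  split_ifs <;> fun_prop

theorem abs_Hmat_apply_le {i : Fin n} {z : Euc n} {C : ℝ} (hC : 0 ≤ C) (hz : ∀ k, |z k| ≤ C)
    (j k : Fin n) : |Hmat i z j k| ≤ C := by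
  unfold Hmat
  split_ifs
  · exact hz _
  · exact hz _
  · simpa using hz _
  · simpa using hC

theorem exists_recenter_of_mem_Vset {φ : Euc n → Matrix (Fin n) (Fin n) ℝ} (hφ : φ ∈ Vset n)
    (c : Euc n) : ∃ (P : Matrix (Fin n) (Fin n) ℝ) (b : Fin n → ℝ),
      ∀ x, φ x = P + ∑ i, b i • Hmat i (x - c) := by
  obtain ⟨A, lam, b, y, -, h⟩ := hφ
  refine ⟨A + lam • 1 + ∑ i, b i • Hmat i (c - y), b, fun x => ?_⟩
  rw [h x, show x - y = (c - y) + (x - c) by abel]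
  simp only [Hmat_add, smul_add, Finset.sum_add_distrib]
  abel

theorem continuous_of_mem_Vset {φ : Euc n → Matrix (Fin n) (Fin n) ℝ} (hφ : φ ∈ Vset n) :
    Continuous φ := by
  obtain ⟨P, b, h⟩ := exists_recenter_of_mem_Vset hφ 0
  rw [funext h]
  have := fun i => continuous_Hmat (n := n) i
  fun_prop

theorem continuous_matDot {U φ : Euc n → Matrix (Fin n) (Fin n) ℝ} (hU : Continuous U)
    (hφ : Continuous φ) : Continuous fun x => matDot (U x) (φ x) := by
  unfold matDot
  exact continuous_finsetSum _ fun j _ => continuous_finsetSum _ fun k _ =>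
    (hU.matrix_elem j k).mul (hφ.matrix_elem j k)

theorem integrableOn_apply_of_matL1 {g : Euc n → Matrix (Fin n) (Fin n) ℝ} {D : Set (Euc n)}
    (hg : AEStronglyMeasurable g (volume.restrict D))
    (hg1 : IntegrableOn (fun x => matL1 (g x)) D) (j k : Fin n) :
    IntegrableOn (fun x => g x j k) D := by
  refine Integrable.mono' hg1 ?_ (ae_of_all _ fun x => abs_apply_le_matL1 (g x) j k)
  exact (continuous_id.matrix_elem j k).comp_aestronglyMeasurable hg

theorem integrableOn_matDot {g φ : Euc n → Matrix (Fin n) (Fin n) ℝ} {D : Set (Euc n)}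
    (hD : MeasurableSet D) (hDb : Bornology.IsBounded D)
    (hg : ∀ j k, IntegrableOn (fun x => g x j k) D) (hφ : Continuous φ) :
    IntegrableOn (fun x => matDot (g x) (φ x)) D := by
  unfold matDot
  refine integrable_finsetSum _ fun j _ => integrable_finsetSum _ fun k _ => ?_
  exact (hg j k).mul_continuousOn_of_subset (hφ.matrix_elem j k).continuousOn hD
    hDb.isCompact_closure subset_closure

theorem setIntegral_openCube_Hmat (c : Euc n) {h : ℝ} (hh : 0 ≤ h) (i j k : Fin n) :
    ∫ x in openCube c h, Hmat i (x - c) j k = 0 := by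
  unfold Hmat
  split_ifs
  · simpa using setIntegral_openCube_coord c hh i
  · simpa using setIntegral_openCube_coord c hh j
  · simpa only [PiLp.sub_apply, integral_neg, neg_eq_zero] using
      setIntegral_openCube_coord c hh k
  · simp

theorem setIntegral_openCube_matDot_Hmat (c : Euc n) {h : ℝ} (hh : 0 ≤ h) (i : Fin n)
    (G : Matrix (Fin n) (Fin n) ℝ) :
    ∫ x in openCube c h, matDot G (Hmat i (x - c)) = 0 := by
  have hint : ∀ j k, IntegrableOn (fun x => G j k * Hmat i (x - c) j k) (openCube c h) :=
    fun j k => Continuous.integrableOn_openCube (continuous_const.mul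
      (((continuous_Hmat i).comp (by fun_prop : Continuous fun x : Euc n => x - c)).matrix_elem
        j k)) c h
  unfold matDot
  rw [integral_finsetSum _ fun j _ => integrable_finsetSum _ fun k _ => hint j k]
  refine Finset.sum_eq_zero fun j _ => ?_
  rw [integral_finsetSum _ fun k _ => hint j k]
  refine Finset.sum_eq_zero fun k _ => ?_
  rw [integral_const_mul, setIntegral_openCube_Hmat c hh, mul_zero]

/-- The field on the cube with center `c` and side `h` whose pairing with `P + ∑ bᵢ Hᵢ(x - c)`
is `G : P + ∑ bᵢ γᵢ`. -/
def momentField (c : Euc n) (h : ℝ) (i₀ : Fin n) (G : Matrix (Fin n) (Fin n) ℝ)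
    (γ : Fin n → ℝ) (x : Euc n) : Matrix (Fin n) (Fin n) ℝ :=
  (h ^ n)⁻¹ • (G + (12 / h ^ 2 * ∑ i, γ i * (x i - c i)) • Matrix.single i₀ i₀ 1)

theorem continuous_momentField (c : Euc n) (h : ℝ) (i₀ : Fin n) (G : Matrix (Fin n) (Fin n) ℝ)
    (γ : Fin n → ℝ) : Continuous (momentField c h i₀ G γ) := by
  unfold momentField
  fun_prop

theorem setIntegral_matDot_momentField (c : Euc n) {h : ℝ} (hh : 0 < h) (i₀ : Fin n)
    (G P : Matrix (Fin n) (Fin n) ℝ) (γ b : Fin n → ℝ) :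
    ∫ x in openCube c h, matDot (momentField c h i₀ G γ x) (P + ∑ i, b i • Hmat i (x - c)) =
      matDot G P + ∑ i, b i * γ i := by
  have hz : ∀ i : Fin n, Continuous fun x : Euc n => x i - c i := fun i => by fun_prop
  have hexp : ∀ x : Euc n,
      matDot (momentField c h i₀ G γ x) (P + ∑ i, b i • Hmat i (x - c)) =
        (h ^ n)⁻¹ * (matDot G P + ∑ i, b i * matDot G (Hmat i (x - c)) +
          12 / h ^ 2 * (∑ i, P i₀ i₀ * γ i * (x i - c i) +
            ∑ i, ∑ j, γ i * b j * ((x i - c i) * (x j - c j)))) := by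
    intro x
    have hdiag : (P + ∑ i, b i • Hmat i (x - c)) i₀ i₀ =
        P i₀ i₀ + ∑ i, b i * (x i - c i) := by
      simp [Matrix.add_apply, Matrix.sum_apply, Hmat_self]
    rw [momentField, matDot_smul_left, matDot_add_left, matDot_smul_left, matDot_single_left,
      hdiag, matDot_add_right, matDot_sum_right]
    simp_rw [matDot_smul_right]
    congr 2
    rw [mul_assoc, mul_add, Finset.sum_mul_sum, Finset.sum_mul]
    congr 2
    · exact Finset.sum_congr rfl fun i _ => by ring
    · exact Finset.sum_congr rfl fun i _ => Finset.sum_congr rfl fun j _ => by ring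
  have hI : ∀ {f : Euc n → ℝ}, Continuous f → IntegrableOn f (openCube c h) :=
    fun hf => hf.integrableOn_openCube c h
  have hH : ∀ i, Continuous fun x : Euc n => b i * matDot G (Hmat i (x - c)) := fun i =>
    continuous_const.mul (continuous_matDot continuous_const
      ((continuous_Hmat i).comp (by fun_prop : Continuous fun x : Euc n => x - c)))
  have hvol : volume.real (openCube c h) = h ^ n := by
    rw [measureReal_def, volume_openCube c hh.le, ENNReal.toReal_ofReal (by positivity)]
  simp_rw [hexp]
  rw [integral_const_mul, integral_add (hI (by fun_prop)) (hI (by fun_prop)),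
    integral_add (hI (by fun_prop)) (hI (by fun_prop)), integral_const_mul,
    integral_add (hI (by fun_prop)) (hI (by fun_prop)),
    integral_finsetSum _ (fun i _ => hI (hH i)),
    integral_finsetSum _ (fun i _ => hI (by fun_prop)),
    integral_finsetSum _ (fun i _ => hI (by fun_prop))]
  simp_rw [integral_const_mul, setIntegral_openCube_matDot_Hmat c hh.le,
    setIntegral_openCube_coord c hh.le]
  have hsum : ∀ i, ∫ x in openCube c h, ∑ j, γ i * b j * ((x i - c i) * (x j - c j)) =
      γ i * b i * (h ^ n * (h ^ 2 / 12)) := by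
    intro i
    rw [integral_finsetSum _ (fun j _ => hI (by fun_prop))]
    simp_rw [integral_const_mul, setIntegral_openCube_coord_mul c hh]
    simp
  simp_rw [hsum]
  simp only [setIntegral_const, hvol, smul_eq_mul, mul_zero, Finset.sum_const_zero, add_zero,
    zero_add, ← Finset.sum_mul]
  simp_rw [mul_comm (b _)]
  field_simp

theorem abs_momentField_apply_le (c : Euc n) {h : ℝ} (hh : 0 < h) (i₀ : Fin n)
    {G : Matrix (Fin n) (Fin n) ℝ} {γ : Fin n → ℝ} {J R : ℝ} (hG : ∀ j k, |G j k| ≤ J)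
    (hγ : ∀ i, |γ i| ≤ J * R) {x : Euc n} (hx : x ∈ openCube c h) (j k : Fin n) :
    |momentField c h i₀ G γ x j k| ≤ (h ^ n)⁻¹ * (J * (1 + 6 * n * (R / h))) := by
  have hs : |∑ i, γ i * (x i - c i)| ≤ n * (J * R * (h / 2)) := by
    refine (Finset.abs_sum_le_sum_abs _ _).trans ?_
    refine (Finset.sum_le_card_nsmul _ _ (J * R * (h / 2)) fun i _ => ?_).trans (by simp)
    rw [abs_mul]
    exact mul_le_mul (hγ i) (hx i).le (abs_nonneg _) ((abs_nonneg _).trans (hγ i))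
  have h1 : |(Matrix.single i₀ i₀ (1 : ℝ) : Matrix (Fin n) (Fin n) ℝ) j k| ≤ 1 := by
    rw [Matrix.single_apply]
    split_ifs <;> simp
  simp only [momentField, Matrix.smul_apply, Matrix.add_apply, smul_eq_mul]
  rw [abs_mul, abs_of_pos (by positivity : (0 : ℝ) < (h ^ n)⁻¹)]
  refine mul_le_mul_of_nonneg_left ?_ (by positivity)
  calc _ ≤ |G j k| + |12 / h ^ 2 * ∑ i, γ i * (x i - c i)| * 1 := by
        refine (abs_add_le _ _).trans (add_le_add le_rfl ?_)
        rw [abs_mul]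
        exact mul_le_mul_of_nonneg_left h1 (abs_nonneg _)
    _ ≤ J + 12 / h ^ 2 * (n * (J * R * (h / 2))) := by
        rw [mul_one, abs_mul, abs_of_pos (by positivity : (0 : ℝ) < 12 / h ^ 2)]
        exact add_le_add (hG j k) (mul_le_mul_of_nonneg_left hs (by positivity))
    _ = _ := by field_simp; ring

/-- A field on a cube with the same pairings against `V` as `g` restricted to `D`. -/
theorem exists_field_setIntegral_matDot_eq {g : Euc n → Matrix (Fin n) (Fin n) ℝ}
    {D : Set (Euc n)} (hn : 0 < n) (hD : MeasurableSet D) (hDb : Bornology.IsBounded D)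
    (hg : AEStronglyMeasurable g (volume.restrict D))
    (hg1 : IntegrableOn (fun x => matL1 (g x)) D) (c : Euc n) {h R : ℝ} (hh : 0 < h)
    (hR : 0 ≤ R) (hDR : ∀ x ∈ D, ∀ i, |x i - c i| ≤ R) :
    ∃ U : Euc n → Matrix (Fin n) (Fin n) ℝ, Continuous U ∧
      (∀ φ ∈ Vset n, ∫ x in openCube c h, matDot (U x) (φ x) = ∫ x in D, matDot (g x) (φ x)) ∧
      ∀ x ∈ openCube c h, ∀ j k, |U x j k| ≤
        (h ^ n)⁻¹ * ((∫ x in D, matL1 (g x)) * (1 + 6 * n * (R / h))) := by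
  have hgjk := integrableOn_apply_of_matL1 hg hg1
  have hH : ∀ i : Fin n, Continuous fun x : Euc n => Hmat i (x - c) := fun i =>
    (continuous_Hmat i).comp (by fun_prop)
  refine ⟨momentField c h ⟨0, hn⟩ (fun j k => ∫ x in D, g x j k)
    (fun i => ∫ x in D, matDot (g x) (Hmat i (x - c))), continuous_momentField _ _ _ _ _, ?_, ?_⟩
  · intro φ hφ
    obtain ⟨P, b, hP⟩ := exists_recenter_of_mem_Vset hφ c
    simp_rw [hP]
    refine (setIntegral_matDot_momentField c hh _ _ _ _ _).trans ?_
    simp_rw [matDot_add_right, matDot_sum_right, matDot_smul_right]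
    rw [integral_add (integrableOn_matDot hD hDb hgjk continuous_const)
      (integrable_finsetSum _ fun i _ => (integrableOn_matDot hD hDb hgjk (hH i)).const_mul _),
      integral_finsetSum _ fun i _ => (integrableOn_matDot hD hDb hgjk (hH i)).const_mul _]
    simp_rw [integral_const_mul]
    congr 1
    unfold matDot
    refine ((integral_finsetSum (f := fun j x => ∑ k, g x j k * P j k) _ fun j _ =>
      integrable_finsetSum _ fun k _ => (hgjk j k).mul_const _).trans
      (Finset.sum_congr rfl fun j _ => ?_)).symm
    refine (integral_finsetSum (f := fun k x => g x j k * P j k) _ fun k _ =>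
      (hgjk j k).mul_const _).trans (Finset.sum_congr rfl fun k _ => ?_)
    exact integral_mul_const _ _
  · intro x hx j k
    refine abs_momentField_apply_le c hh _ (fun j k => ?_) (fun i => ?_) hx j k
    · exact norm_integral_le_of_norm_le (f := fun x => g x j k) hg1
        (ae_of_all _ fun x => abs_apply_le_matL1 (g x) j k)
    · rw [← integral_mul_const]
      refine norm_integral_le_of_norm_le (f := fun x => matDot (g x) (Hmat i (x - c)))
        (hg1.mul_const R) ((ae_restrict_iff' hD).2 (ae_of_all _ fun x hx => ?_))
      exact abs_matDot_le fun j k => abs_Hmat_apply_le hR (fun i => by simpa using hDR x hx i) j k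

end VSpace

section WhitneyGeometry

variable {n : ℕ} {Ω : Set (Euc n)} {Γ : Type} {wd : WhitneyDecomp n Ω Γ}

theorem closedCube_subset_extCube (wd : WhitneyDecomp n Ω Γ) (t : Γ) :
    closedCube (wd.c t) (wd.s t) ⊆ extCube wd t := fun x hx i => by
  have := wd.s_pos t
  have := hx i
  linarith

theorem extCube_subset (wd : WhitneyDecomp n Ω Γ) (hΩ : IsOpen Ω) (t : Γ) : extCube wd t ⊆ Ω := by
  intro y hy
  set c := wd.c t with hc
  have hs := wd.s_pos t
  have hQΩ : closedCube c (wd.s t) ⊆ Ω := fun x hx => wd.cover ▸ mem_iUnion.2 ⟨t, hx⟩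
  have hp : ∀ σ : ℝ, |σ| = 8 / 9 → c + σ • (y - c) ∈ closedCube c (wd.s t) := by
    intro σ hσ i
    have := hy i
    simp only [PiLp.add_apply, PiLp.smul_apply, PiLp.sub_apply, smul_eq_mul, add_sub_cancel_left,
      abs_mul, hσ]
    linarith
  by_cases hyc : y = c
  · refine hQΩ fun i => ?_
    simpa [hyc] using (half_pos hs).le
  set x := c + (8 / 9 : ℝ) • (y - c) with hx
  have hxQ : x ∈ closedCube c (wd.s t) := hp _ (by norm_num)
  have hdist : 16 / 9 * ‖y - c‖ ≤ Metric.diam (closedCube c (wd.s t)) := by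
    have := dist_le_diam_of_mem (isBounded_closedCube c (wd.s t)) hxQ
      (hp (-(8 / 9)) (by norm_num))
    rwa [dist_eq_norm, show x - (c + (-(8 / 9) : ℝ) • (y - c)) = (16 / 9 : ℝ) • (y - c) by
      rw [hx]; module, norm_smul, Real.norm_of_nonneg (by norm_num)] at this
  have hyx : dist y x = 1 / 9 * ‖y - c‖ := by
    rw [dist_eq_norm, show y - x = (1 / 9 : ℝ) • (y - c) by rw [hx]; module, norm_smul,
      Real.norm_of_nonneg (by norm_num)]
  have hpos : 0 < ‖y - c‖ := norm_pos_iff.2 (sub_ne_zero.2 hyc)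
  have hball : ball x (Metric.diam (closedCube c (wd.s t))) ⊆ Ω ∪ (closure Ω)ᶜ := by
    intro z hz
    by_contra hcon
    simp only [mem_union, mem_compl_iff, not_or, not_not] at hcon
    have hzf : z ∈ frontier Ω := by
      rw [hΩ.frontier_eq]
      exact ⟨hcon.2, hcon.1⟩
    have h1 := wd.diam_le_dist t x hxQ
    have h2 := infDist_le_dist_of_mem (x := x) hzf
    rw [mem_ball, dist_comm] at hz
    linarith
  have hsub := (isPreconnected_ball (x := x)).subset_left_of_subset_union hΩ
    isClosed_closure.isOpen_compl (disjoint_compl_right_iff_subset.2 subset_closure) hball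
    ⟨x, mem_ball_self (by linarith), hQΩ hxQ⟩
  exact hsub (by rw [mem_ball, hyx]; linarith)

theorem treeLE_refl (T : TreeStruct wd) (t : Γ) : treeLE T t t := ⟨0, rfl⟩

theorem treeLE.trans {T : TreeStruct wd} {s t u : Γ} (h₁ : treeLE T s t) (h₂ : treeLE T t u) :
    treeLE T s u := by
  obtain ⟨k, rfl⟩ := h₁
  obtain ⟨l, rfl⟩ := h₂
  exact ⟨k + l, Function.iterate_add_apply _ _ _ _⟩

theorem treeLE_parent (T : TreeStruct wd) (t : Γ) : treeLE T (T.parent t) t := ⟨1, rfl⟩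

theorem treeLE_root (T : TreeStruct wd) (t : Γ) : treeLE T T.root t := T.reaches_root t

theorem iterate_parent_root (T : TreeStruct wd) (k : ℕ) : T.parent^[k] T.root = T.root :=
  Function.iterate_fixed T.parent_root k

theorem eq_root_of_treeLE_parent {T : TreeStruct wd} {t : Γ} (h : treeLE T t (T.parent t)) :
    t = T.root := by
  obtain ⟨j, hj⟩ := h
  rw [← Function.iterate_succ_apply] at hj
  obtain ⟨k, hk⟩ := T.reaches_root t
  have hp : T.parent^[(j + 1) * k] t = t :=
    (show Function.IsPeriodicPt T.parent (j + 1) t from hj).mul_const k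
  rw [← hp, show (j + 1) * k = j * k + k by ring, Function.iterate_add_apply, hk,
    iterate_parent_root]

theorem exists_child_treeLE {T : TreeStruct wd} {t s : Γ} (h : treeLE T t s) (hts : t ≠ s) :
    ∃ c, c ≠ T.root ∧ T.parent c = t ∧ treeLE T c s := by
  obtain ⟨k, hk⟩ := h
  induction k with
  | zero => exact absurd hk.symm hts
  | succ k ih =>
    by_cases hc : T.parent^[k] s = T.root
    · refine ih ?_
      rw [← hk, Function.iterate_succ_apply', hc, T.parent_root]
    · exact ⟨_, hc, by rw [← hk, Function.iterate_succ_apply'], k, rfl⟩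

theorem treeLE_or_treeLE {T : TreeStruct wd} {c c' s : Γ} (h : treeLE T c s)
    (h' : treeLE T c' s) : treeLE T c c' ∨ treeLE T c' c := by
  obtain ⟨k, rfl⟩ := h
  obtain ⟨l, rfl⟩ := h'
  rcases le_total k l with hkl | hkl
  · exact Or.inr ⟨l - k, by rw [← Function.iterate_add_apply, Nat.sub_add_cancel hkl]⟩
  · exact Or.inl ⟨k - l, by rw [← Function.iterate_add_apply, Nat.sub_add_cancel hkl]⟩

theorem eq_of_treeLE_of_parent_eq {T : TreeStruct wd} {c c' : Γ} (hc : c ≠ T.root)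
    (h : treeLE T c c') (hp : T.parent c = T.parent c') : c = c' := by
  obtain ⟨k, hk⟩ := h
  cases k with
  | zero => exact hk.symm
  | succ k =>
    rw [Function.iterate_succ_apply, ← hp] at hk
    exact absurd (eq_root_of_treeLE_parent ⟨k, hk⟩) hc

theorem eq_of_child_treeLE {T : TreeStruct wd} {c c' s : Γ} (hc : c ≠ T.root)
    (hc' : c' ≠ T.root) (hp : T.parent c = T.parent c') (h : treeLE T c s)
    (h' : treeLE T c' s) : c = c' :=
  (treeLE_or_treeLE h h').elim (fun H => eq_of_treeLE_of_parent_eq hc H hp)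
    fun H => (eq_of_treeLE_of_parent_eq hc' H hp.symm).symm

open Classical in
/-- Sums over descendants of `t` split into the term at `t` and the sums over descendants of
the children of `t`. -/
theorem sum_treeLE_eq_add_sum_children (T : TreeStruct wd) (S A : Finset Γ)
    (hA : ∀ s ∈ S, ∀ t, treeLE T t s → t ∈ A) (m : Γ → ℝ) (t : Γ) :
    ∑ s ∈ S with treeLE T t s, m s = (if t ∈ S then m t else 0) +
      ∑ c ∈ A with (T.parent c = t ∧ c ≠ T.root), ∑ s ∈ S with treeLE T c s, m s := by
  have hswap : ∑ c ∈ A with (T.parent c = t ∧ c ≠ T.root), ∑ s ∈ S with treeLE T c s, m s =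
      ∑ s ∈ S, ∑ c ∈ A with (T.parent c = t ∧ c ≠ T.root), if treeLE T c s then m s else 0 := by
    rw [Finset.sum_comm]
    simp_rw [Finset.sum_filter]
  rw [hswap, Finset.sum_filter, ← Finset.sum_ite_eq S t m, ← Finset.sum_add_distrib]
  refine Finset.sum_congr rfl fun s hs => ?_
  by_cases hts : treeLE T t s
  · rw [if_pos hts]
    by_cases h : t = s
    · subst h
      rw [if_pos rfl, left_eq_add]
      refine Finset.sum_eq_zero fun c hc => if_neg fun hcs => ?_
      obtain ⟨-, rfl, hcr⟩ := Finset.mem_filter.1 hc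
      exact hcr (eq_root_of_treeLE_parent hcs)
    · obtain ⟨c, hcr, hct, hcs⟩ := exists_child_treeLE hts h
      rw [if_neg h, zero_add, Finset.sum_eq_single_of_mem c
        (Finset.mem_filter.2 ⟨hA s hs c hcs, hct, hcr⟩), if_pos hcs]
      intro c' hc' hne
      obtain ⟨-, hct', hcr'⟩ := Finset.mem_filter.1 hc'
      exact if_neg fun hcs' =>
        hne (eq_of_child_treeLE hcr' hcr (hct'.trans hct.symm) hcs' hcs)
  · rw [if_neg hts, if_neg (by rintro rfl; exact hts (treeLE_refl T t)), zero_add]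
    refine (Finset.sum_eq_zero fun c hc => if_neg fun hcs => hts ?_).symm
    obtain ⟨-, rfl, -⟩ := Finset.mem_filter.1 hc
    exact (treeLE_parent T c).trans hcs

theorem finite_subtreeOf (T : TreeStruct wd) (g : Euc n → Matrix (Fin n) (Fin n) ℝ)
    (hfin : {t : Γ | (Function.support g ∩ extCube wd t).Nonempty}.Finite) :
    (subtreeOf T g).Finite := by
  classical
  have : subtreeOf T g = ⋃ k ∈ {t : Γ | (Function.support g ∩ extCube wd t).Nonempty},
      {s | treeLE T s k} := by
    ext s
    simp only [subtreeOf, mem_ofPred_eq, mem_iUnion, exists_prop]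
    exact exists_congr fun k => and_comm
  rw [this]
  refine hfin.biUnion fun k _ => ?_
  obtain ⟨N, hN⟩ := T.reaches_root k
  refine ((Finset.range (N + 1)).image fun j => T.parent^[j] k).finite_toSet.subset ?_
  rintro s ⟨j, rfl⟩
  simp only [Finset.coe_image, Set.mem_image, Finset.mem_coe, Finset.mem_range]
  rcases le_total j N with hj | hj
  · exact ⟨j, by omega, rfl⟩
  · refine ⟨N, by omega, ?_⟩
    rw [← Nat.sub_add_cancel hj, Function.iterate_add_apply, hN, iterate_parent_root]

theorem abs_sub_le_of_mem_shadow {T : TreeStruct wd} {K : ℝ} {t : Γ}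
    (hK : ∀ s, treeLE T t s →
      closedCube (wd.c s) (wd.s s) ⊆ closedCube (wd.c t) (K * wd.s t))
    {x : Euc n} (hx : x ∈ shadow T t) (i : Fin n) :
    |x i - wd.c t i| ≤ 5 / 8 * (K * wd.s t) := by
  simp only [shadow, mem_iUnion] at hx
  obtain ⟨s, hts, hxs⟩ := hx
  have hs := wd.s_pos s
  have h1 := hK s hts (show wd.c s ∈ closedCube (wd.c s) (wd.s s) from fun i => by
    simpa using (half_pos hs).le) i
  have h2 := hK s hts (show wd.c s + (8 / 9 : ℝ) • (x - wd.c s) ∈ closedCube (wd.c s) (wd.s s)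
    from fun i => by
      have := hxs i
      simp only [PiLp.add_apply, PiLp.smul_apply, PiLp.sub_apply, smul_eq_mul,
        add_sub_cancel_left, abs_mul]
      rw [abs_of_pos (by norm_num : (0 : ℝ) < 8 / 9)]
      linarith) i
  simp only [PiLp.add_apply, PiLp.smul_apply, PiLp.sub_apply, smul_eq_mul] at h2
  rw [abs_le] at h1 h2 ⊢
  constructor <;> linarith [h1.1, h1.2, h2.1, h2.2]

theorem isOpen_shadow (T : TreeStruct wd) (t : Γ) : IsOpen (shadow T t) :=
  isOpen_iUnion fun _ => isOpen_iUnion fun _ => isOpen_openCube _ _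

theorem shadow_subset (T : TreeStruct wd) (hΩ : IsOpen Ω) (t : Γ) : shadow T t ⊆ Ω :=
  iUnion₂_subset fun s _ => extCube_subset wd hΩ s

theorem extCube_subset_shadow {T : TreeStruct wd} {s t : Γ} (h : treeLE T t s) :
    extCube wd s ⊆ shadow T t :=
  subset_iUnion₂_of_subset s h Subset.rfl

theorem volume_shadow_toReal_pos (T : TreeStruct wd) (hΩ : Bornology.IsBounded Ω)
    (hΩo : IsOpen Ω) (t : Γ) : 0 < (volume (shadow T t)).toReal := by
  refine ENNReal.toReal_pos (ne_of_gt ?_)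
    (hΩ.subset (shadow_subset T hΩo t)).measure_lt_top.ne
  refine (isOpen_shadow T t).measure_pos _ ⟨wd.c t, extCube_subset_shadow (treeLE_refl T t) ?_⟩
  exact self_mem_openCube _ (mul_pos (by norm_num) (wd.s_pos t))

theorem volume_shadow_toReal_le {T : TreeStruct wd} {K : ℝ} (hK0 : 0 < K) {t : Γ}
    (hK : ∀ s, treeLE T t s →
      closedCube (wd.c s) (wd.s s) ⊆ closedCube (wd.c t) (K * wd.s t)) :
    (volume (shadow T t)).toReal ≤ (3 * K * wd.s t) ^ n := by
  have hs := mul_pos hK0 (wd.s_pos t)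
  have hsub : shadow T t ⊆ openCube (wd.c t) (3 * K * wd.s t) := fun x hx i =>
    (abs_sub_le_of_mem_shadow hK hx i).trans_lt (by linarith)
  refine ENNReal.toReal_le_of_le_ofReal (by rw [mul_assoc]; positivity)
    ((measure_mono hsub).trans_eq (volume_openCube _ (by rw [mul_assoc]; positivity)))

theorem hardyT_eq {T : TreeStruct wd} {Bc : Γ → Euc n} {Bh : Γ → ℝ}
    (hB : ∀ t t', t ≠ t' → t ≠ T.root → t' ≠ T.root →
      openCube (Bc t) (Bh t) ∩ openCube (Bc t') (Bh t') = ∅) (u : Euc n → ℝ) {s : Γ}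
    (hs : s ≠ T.root) {x : Euc n} (hx : x ∈ openCube (Bc s) (Bh s)) :
    hardyT T Bc Bh u x = (∫ y in shadow T s, |u y|) / (volume (shadow T s)).toReal := by
  rw [hardyT, finsum_eq_single _ s, if_neg hs, indicator_of_mem hx]
  intro t hts
  split_ifs with htr
  · rfl
  · refine indicator_of_notMem (fun hxt => ?_) _
    have : x ∈ openCube (Bc t) (Bh t) ∩ openCube (Bc s) (Bh s) := ⟨hxt, hx⟩
    rw [hB t s hts htr hs] at this
    exact this

end WhitneyGeometry

section Decomposition

theorem exists_measurable_disjoint_refinement {α Γ : Type*} [TopologicalSpace α]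
    [MeasurableSpace α] [BorelSpace α] (S : Finset Γ) {X : Γ → Set α} (hX : ∀ t, IsOpen (X t)) :
    ∃ E : Γ → Set α, (∀ t, E t ⊆ X t) ∧ (∀ t, MeasurableSet (E t)) ∧
      (∀ t ∈ S, ∀ t' ∈ S, t ≠ t' → Disjoint (E t) (E t')) ∧
      ∀ x, (∃ t ∈ S, x ∈ X t) → ∃ t ∈ S, x ∈ E t := by
  refine ⟨fun t => X t \ ⋃ t' ∈ {t' | t' ∈ S ∧ WellOrderingRel t' t}, X t', fun t => sdiff_subset,
    fun t => (hX t).measurableSet.diff (isOpen_biUnion fun t' _ => hX t').measurableSet, ?_, ?_⟩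
  · intro t ht t' ht' hne
    refine Set.disjoint_left.2 fun x hx hx' => ?_
    rcases trichotomous_of WellOrderingRel t t' with h | h | h
    · exact hx'.2 (mem_biUnion (show t ∈ {s | s ∈ S ∧ WellOrderingRel s t'} from ⟨ht, h⟩) hx.1)
    · exact hne h
    · exact hx.2 (mem_biUnion (show t' ∈ {s | s ∈ S ∧ WellOrderingRel s t} from ⟨ht', h⟩) hx'.1)
  · rintro x ⟨t, ht, hxt⟩
    obtain ⟨m, ⟨hm, hxm⟩, hmin⟩ := (IsWellFounded.wf (r := @WellOrderingRel Γ)).has_min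
      {s | s ∈ S ∧ x ∈ X s} ⟨t, ht, hxt⟩
    refine ⟨m, hm, hxm, fun hx => ?_⟩
    obtain ⟨s, ⟨hs, hsm⟩, hxs⟩ := mem_iUnion₂.1 hx
    exact hmin s ⟨hs, hxs⟩ hsm

theorem correction_constant_le {n : ℕ} (hn : n ≠ 0) {CB K s h W J : ℝ} (hCB : 0 < CB)
    (hK : 1 < K) (hs : 0 < s) (hh : 0 < h) (hsh : s ^ n ≤ CB * h ^ n) (hW : 0 < W)
    (hWle : W ≤ (3 * K * s) ^ n) (hJ : 0 ≤ J) :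
    (h ^ n)⁻¹ * (J * (1 + 6 * n * (2 * K * s / h))) ≤
      CB * 3 ^ n * (1 + 12 * n * (1 + CB)) * K ^ (n + 1) * (J / W) := by
  have hK0 : 0 < K := by linarith
  have hratio : s / h ≤ 1 + CB := by
    rcases le_total (s / h) 1 with h1 | h1
    · linarith
    · have h2 : s / h ≤ (s / h) ^ n := le_self_pow₀ h1 hn
      rw [div_pow] at h2
      have h3 : s ^ n / h ^ n ≤ CB := (div_le_iff₀ (by positivity)).2 hsh
      linarith
  have hlin : 1 + 6 * n * (2 * K * s / h) ≤ (1 + 12 * n * (1 + CB)) * K := by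
    have h1 : n * K * (s / h) ≤ n * K * (1 + CB) :=
      mul_le_mul_of_nonneg_left hratio (by positivity)
    calc 1 + 6 * n * (2 * K * s / h) = 1 + 12 * (n * K * (s / h)) := by ring
      _ ≤ K + 12 * (n * K * (1 + CB)) := by linarith
      _ = _ := by ring
  have hvol : (h ^ n)⁻¹ ≤ CB * 3 ^ n * K ^ n / W := by
    rw [inv_le_iff_one_le_mul₀ (by positivity), div_mul_eq_mul_div, one_le_div hW]
    calc W ≤ (3 * K * s) ^ n := hWle
      _ = 3 ^ n * K ^ n * s ^ n := by rw [mul_pow, mul_pow]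
      _ ≤ 3 ^ n * K ^ n * (CB * h ^ n) := mul_le_mul_of_nonneg_left hsh (by positivity)
      _ = _ := by ring
  calc _ ≤ CB * 3 ^ n * K ^ n / W * (J * ((1 + 12 * n * (1 + CB)) * K)) := by gcongr
    _ = _ := by ring

variable {n : ℕ} {Ω : Set (Euc n)} {Γ : Type} {wd : WhitneyDecomp n Ω Γ}

theorem side_pow_le {CB h : ℝ} {c : Euc n} {t : Γ} (hCB : 0 < CB) (hh : 0 < h)
    (hvol : volume (extCube wd t) ≤ ENNReal.ofReal CB * volume (openCube c h)) :
    wd.s t ^ n ≤ CB * h ^ n := by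
  have hs := wd.s_pos t
  rw [extCube, volume_openCube _ (by positivity), volume_openCube _ hh.le,
    ← ENNReal.ofReal_mul hCB.le, ENNReal.ofReal_le_ofReal_iff (by positivity)] at hvol
  exact (pow_le_pow_left₀ hs.le (by linarith) n).trans hvol

/-- A field on `B_t` carrying the pairings of `g` over a subset `D` of the shadow of `t`. -/
theorem exists_correction {T : TreeStruct wd} (hn : 0 < n) (hΩ : IsOpen Ω)
    (hΩb : Bornology.IsBounded Ω) {CB K : ℝ} (hCB : 0 < CB) (hK1 : 1 < K) {t : Γ}
    (hK : ∀ s, treeLE T t s →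
      closedCube (wd.c s) (wd.s s) ⊆ closedCube (wd.c t) (K * wd.s t))
    {c : Euc n} {h : ℝ} (hh : 0 < h) (hsub : openCube c h ⊆ extCube wd t)
    (hvol : volume (extCube wd t) ≤ ENNReal.ofReal CB * volume (openCube c h))
    {g : Euc n → Matrix (Fin n) (Fin n) ℝ}
    (hg : AEStronglyMeasurable g (volume.restrict Ω))
    (hg1 : IntegrableOn (fun x => matL1 (g x)) Ω) {D : Set (Euc n)} (hD : MeasurableSet D)
    (hDW : D ⊆ shadow T t) :
    ∃ U : Euc n → Matrix (Fin n) (Fin n) ℝ, Continuous U ∧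
      (∀ φ ∈ Vset n, ∫ x in openCube c h, matDot (U x) (φ x) = ∫ x in D, matDot (g x) (φ x)) ∧
      (D = ∅ → ∀ x ∈ openCube c h, U x = 0) ∧
      ∀ x ∈ openCube c h, ∀ j k, |U x j k| ≤ CB * 3 ^ n * (1 + 12 * n * (1 + CB)) *
        K ^ (n + 1) * ((∫ y in shadow T t, |matL1 (g y)|) / (volume (shadow T t)).toReal) := by
  have hs := wd.s_pos t
  have hK0 : 0 < K := by linarith
  have hWΩ := shadow_subset T hΩ t
  have hDΩ := hDW.trans hWΩ
  have hKs : wd.s t ≤ K * wd.s t := le_mul_of_one_le_left hs.le hK1.le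
  obtain ⟨U, hUc, hUφ, hUb⟩ := exists_field_setIntegral_matDot_eq (R := 2 * K * wd.s t) hn hD
    (hΩb.subset hDΩ) (hg.mono_set hDΩ) (hg1.mono_set hDΩ) c hh (by positivity) (by
      intro x hx i
      have h1 := abs_sub_le_of_mem_shadow hK (hDW hx) i
      have h2 := hsub (self_mem_openCube c hh) i
      rw [abs_lt] at h2
      rw [abs_le] at h1 ⊢
      constructor <;> linarith [h1.1, h1.2, h2.1, h2.2])
  refine ⟨U, hUc, hUφ, ?_, fun x hx j k => (hUb x hx j k).trans ?_⟩
  · rintro rfl x hx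
    ext j k
    simpa using hUb x hx j k
  · have habs : ∀ y, |matL1 (g y)| = matL1 (g y) := fun y => abs_of_nonneg (matL1_nonneg _)
    simp_rw [habs]
    have hJ : ∫ x in D, matL1 (g x) ≤ ∫ x in shadow T t, matL1 (g x) :=
      setIntegral_mono_set (hg1.mono_set hWΩ) (ae_of_all _ fun x => matL1_nonneg _)
        hDW.eventuallyLE
    refine le_trans ?_ (correction_constant_le hn.ne' hCB hK1 hs hh (side_pow_le hCB hh hvol)
      (volume_shadow_toReal_pos T hΩb hΩ t) (volume_shadow_toReal_le hK0 hK)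
      (integral_nonneg fun x => matL1_nonneg _))
    gcongr

theorem matDot_indicator (B : Set (Euc n)) (U φ : Euc n → Matrix (Fin n) (Fin n) ℝ) (x : Euc n) :
    matDot (B.indicator U x) (φ x) = B.indicator (fun x => matDot (U x) (φ x)) x := by
  by_cases hx : x ∈ B <;> simp [hx]

theorem setIntegral_matDot_indicator {B Y : Set (Euc n)} (hB : MeasurableSet B) (hBY : B ⊆ Y)
    (U φ : Euc n → Matrix (Fin n) (Fin n) ℝ) :
    ∫ x in Y, matDot (B.indicator U x) (φ x) = ∫ x in B, matDot (U x) (φ x) := by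
  simp_rw [matDot_indicator]
  rw [setIntegral_indicator hB, inter_eq_right.2 hBY]

theorem integrableOn_matDot_indicator {B : Set (Euc n)} (hB : MeasurableSet B)
    (Y : Set (Euc n)) {U φ : Euc n → Matrix (Fin n) (Fin n) ℝ}
    (h : IntegrableOn (fun x => matDot (U x) (φ x)) B) :
    IntegrableOn (fun x => matDot (B.indicator U x) (φ x)) Y := by
  simp_rw [matDot_indicator]
  exact ((integrable_indicator_iff hB).2 h).integrableOn

theorem matLinf_indicator_le (B : Set (Euc n)) (g : Euc n → Matrix (Fin n) (Fin n) ℝ)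
    (x : Euc n) : matLinf (B.indicator g x) ≤ matLinf (g x) := by
  by_cases hx : x ∈ B
  · rw [indicator_of_mem hx]
  · rw [indicator_of_notMem hx]
    exact matLinf_le (matLinf_nonneg _) fun j k => by simpa using matLinf_nonneg (g x)

theorem matLinf_le_add {M N L : Matrix (Fin n) (Fin n) ℝ} {C : ℝ} (hM : matLinf M ≤ matLinf L)
    (hN : ∀ j k, |N j k| ≤ C) (hC : 0 ≤ C) : matLinf (M + N) ≤ matLinf L + C :=
  matLinf_le (add_nonneg (matLinf_nonneg _) hC) fun j k => (abs_add_le _ _).trans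
    (add_le_add ((abs_apply_le_matLinf M j k).trans hM) (hN j k))

end Decomposition

/-- pointwise construction of the `V`-decomposition on a bounded John
domain, with pointwise estimates `‖g_t‖_∞(x) ≤ ‖g‖_∞(x) + C_n K^{n+1} T‖g‖₁(x)` on the
cubes `B_s` with `s = t` or `s_p = t`, and `‖g_t‖_∞(x) ≤ ‖g‖_∞(x)` elsewhere; the
constant `C_n` depends only on `n` (and the dimensional constant `CB` of the `B_t`). -/
theorem pointwise_V_decomposition
    (n : ℕ) (hn : 3 ≤ n) (CB : ℝ) (hCB : 0 < CB) :
    ∃ Cn : ℝ, 0 < Cn ∧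
      ∀ (Ω : Set (Euc n)), IsOpen Ω → IsConnected Ω → Bornology.IsBounded Ω →
        IsJohnDomain Ω →
      ∀ (Γ : Type) (wd : WhitneyDecomp n Ω Γ) (T : TreeStruct wd) (K : ℝ), 1 < K →
        (∀ s t : Γ, treeLE T t s →
          closedCube (wd.c s) (wd.s s) ⊆ closedCube (wd.c t) (K * wd.s t)) →
      ∀ (Bc : Γ → Euc n) (Bh : Γ → ℝ),
        (∀ t, t ≠ T.root → 0 < Bh t ∧
          openCube (Bc t) (Bh t) ⊆ extCube wd t ∩ extCube wd (T.parent t)) →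
        (∀ t t', t ≠ t' → t ≠ T.root → t' ≠ T.root →
          openCube (Bc t) (Bh t) ∩ openCube (Bc t') (Bh t') = ∅) →
        (∀ t, t ≠ T.root →
          volume (extCube wd t) ≤ ENNReal.ofReal CB * volume (openCube (Bc t) (Bh t))) →
      ∀ g : Euc n → Matrix (Fin n) (Fin n) ℝ,
        AEStronglyMeasurable g (volume.restrict Ω) →
        IntegrableOn (fun x => matL1 (g x)) Ω →
        (∀ φ ∈ Vset n, ∫ x in Ω, matDot (g x) (φ x) = 0) →
        {t : Γ | (Function.support g ∩ extCube wd t).Nonempty}.Finite →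
        ∃ gt : Γ → Euc n → Matrix (Fin n) (Fin n) ℝ,
          (∀ x ∈ Ω, g x = ∑ᶠ t, gt t x) ∧
          (∀ t, Function.support (gt t) ⊆ extCube wd t) ∧
          (∀ t, ∀ φ ∈ Vset n, ∫ x in extCube wd t, matDot (gt t x) (φ x) = 0) ∧
          (∀ t x, (∃ s, s ≠ T.root ∧ x ∈ openCube (Bc s) (Bh s) ∧
              (s = t ∨ T.parent s = t)) →
            matLinf (gt t x) ≤ matLinf (g x) +
              Cn * K ^ (n + 1) * hardyT T Bc Bh (fun y => matL1 (g y)) x) ∧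
          (∀ t x, ¬(∃ s, s ≠ T.root ∧ x ∈ openCube (Bc s) (Bh s) ∧
              (s = t ∨ T.parent s = t)) →
            matLinf (gt t x) ≤ matLinf (g x)) ∧
          (subtreeOf T g).Finite ∧
          (∀ t, t ∉ subtreeOf T g → gt t = 0) := by
  classical
  have hn0 : 0 < n := by omega
  refine ⟨CB * 3 ^ n * (1 + 12 * n * (1 + CB)), by positivity, ?_⟩
  intro Ω hΩ _ hΩb _ Γ wd T K hK1 hK Bc Bh hB hBdisj hBvol g hg hg1 hgV hfin
  have hgjk := integrableOn_apply_of_matL1 hg hg1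
  have hsubfin := finite_subtreeOf T g hfin
  obtain ⟨S, hS⟩ := hfin.exists_finset
  obtain ⟨A, hA⟩ := hsubfin.exists_finset
  have hSA : ∀ s ∈ S, ∀ t, treeLE T t s → t ∈ A := fun s hs t hts =>
    (hA t).2 ⟨s, hts, (hS s).1 hs⟩
  obtain ⟨E, hEsub, hEm, hEdisj, hEcov⟩ :=
    exists_measurable_disjoint_refinement S fun t => isOpen_openCube (wd.c t) (9 / 8 * wd.s t)
  have hEcov' : ∀ x ∈ Ω, g x ≠ 0 → ∃ t ∈ S, x ∈ E t := by
    intro x hx hgx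
    rw [← wd.cover, mem_iUnion] at hx
    obtain ⟨t, ht⟩ := hx
    have hxt := closedCube_subset_extCube wd t ht
    exact hEcov x ⟨t, (hS t).2 ⟨x, hgx, hxt⟩, hxt⟩
  have hEΩ : ∀ t, E t ⊆ Ω := fun t => (hEsub t).trans (extCube_subset wd hΩ t)
  set D : Γ → Set (Euc n) := fun t => ⋃ s ∈ S.filter (treeLE T t), E s with hDdef
  have hDm : ∀ t, MeasurableSet (D t) := fun t => Finset.measurableSet_biUnion _ fun s _ => hEm s
  have hDW : ∀ t, D t ⊆ shadow T t := fun t => iUnion₂_subset fun s hs =>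
    (hEsub s).trans (extCube_subset_shadow (Finset.mem_filter.1 hs).2)
  have hDempty : ∀ t, t ∉ A → D t = ∅ := fun t ht => subset_empty_iff.1 <|
    iUnion₂_subset fun s hs =>
      (ht (hSA s (Finset.mem_filter.1 hs).1 t (Finset.mem_filter.1 hs).2)).elim
  have hgφ : ∀ φ ∈ Vset n, IntegrableOn (fun x => matDot (g x) (φ x)) Ω := fun φ hφ =>
    integrableOn_matDot hΩ.measurableSet hΩb hgjk (continuous_of_mem_Vset hφ)
  have hDint : ∀ φ ∈ Vset n, ∀ t, ∫ x in D t, matDot (g x) (φ x) =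
      ∑ s ∈ S with treeLE T t s, ∫ x in E s, matDot (g x) (φ x) := fun φ hφ t =>
    integral_biUnion_finset _ (fun s _ => hEm s)
      (fun s hs s' hs' hne => hEdisj s (Finset.mem_filter.1 hs).1 s' (Finset.mem_filter.1 hs').1 hne)
      fun s _ => (hgφ φ hφ).mono_set (hEΩ s)
  have hDroot : ∀ φ ∈ Vset n, ∫ x in D T.root, matDot (g x) (φ x) = 0 := by
    intro φ hφ
    rw [← hgV φ hφ]
    refine (setIntegral_eq_of_subset_of_forall_sdiff_eq_zero hΩ.measurableSet
      (iUnion₂_subset fun s _ => hEΩ s) fun x hx => ?_).symm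
    by_contra hne
    obtain ⟨t, ht, hxt⟩ := hEcov' x hx.1 fun h0 => hne (by rw [h0, matDot_zero_left])
    exact hx.2 (mem_biUnion (Finset.mem_coe.2 (Finset.mem_filter.2 ⟨ht, treeLE_root T t⟩)) hxt)
  have hU : ∀ t, ∃ U : Euc n → Matrix (Fin n) (Fin n) ℝ, t ≠ T.root → Continuous U ∧
      (∀ φ ∈ Vset n, ∫ x in openCube (Bc t) (Bh t), matDot (U x) (φ x) =
        ∫ x in D t, matDot (g x) (φ x)) ∧
      (D t = ∅ → ∀ x ∈ openCube (Bc t) (Bh t), U x = 0) ∧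
      ∀ x ∈ openCube (Bc t) (Bh t), ∀ j k, |U x j k| ≤ CB * 3 ^ n * (1 + 12 * n * (1 + CB)) *
        K ^ (n + 1) * ((∫ y in shadow T t, |matL1 (g y)|) / (volume (shadow T t)).toReal) := by
    intro t
    by_cases ht : t = T.root
    · exact ⟨0, fun h => absurd ht h⟩
    · obtain ⟨U, hU⟩ := exists_correction hn0 hΩ hΩb hCB hK1 (fun s hs => hK s t hs) (hB t ht).1
        ((hB t ht).2.trans inter_subset_left) (hBvol t ht) hg hg1 (hDm t) (hDW t)
      exact ⟨U, fun _ => hU⟩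
  choose U hU using hU
  -- the corrections, extended by zero, with none at the root
  set B : Γ → Set (Euc n) := fun t => if t = T.root then ∅ else openCube (Bc t) (Bh t)
  have hBne : ∀ t, t ≠ T.root → B t = openCube (Bc t) (Bh t) := fun t ht => if_neg ht
  have hBroot : B T.root = ∅ := if_pos rfl
  have hBm : ∀ t, MeasurableSet (B t) := fun t => by
    by_cases ht : t = T.root
    · rw [ht, hBroot]; exact MeasurableSet.empty
    · rw [hBne t ht]; exact measurableSet_openCube _ _
  have hBsub : ∀ t, B t ⊆ extCube wd t ∩ extCube wd (T.parent t) := fun t => by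
    by_cases ht : t = T.root
    · rw [ht, hBroot]; exact empty_subset _
    · rw [hBne t ht]; exact (hB t ht).2
  set H : Γ → Euc n → Matrix (Fin n) (Fin n) ℝ := fun t => (B t).indicator (U t) with hHdef
  have hHzero : ∀ t, t ∉ A → H t = 0 := by
    intro t ht
    refine indicator_eq_zero'.2 (Set.disjoint_left.2 fun x hx hxB => hx ?_)
    by_cases htr : t = T.root
    · rw [htr, hBroot] at hxB; exact hxB.elim
    · rw [hBne t htr] at hxB
      exact (hU t htr).2.2.1 (hDempty t ht) x hxB
  have hHother : ∀ s, s ≠ T.root → ∀ x ∈ openCube (Bc s) (Bh s), ∀ c, c ≠ s → H c x = 0 := by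
    intro s hs x hx c hcs
    refine indicator_of_notMem (fun hxc => ?_) _
    by_cases hcr : c = T.root
    · rw [hcr, hBroot] at hxc; exact hxc
    · rw [hBne c hcr] at hxc
      exact (hBdisj c s hcs hcr hs).subset ⟨hxc, hx⟩
  have hHφ : ∀ φ ∈ Vset n, ∀ t Y, B t ⊆ Y →
      ∫ x in Y, matDot (H t x) (φ x) = ∫ x in D t, matDot (g x) (φ x) := by
    intro φ hφ t Y hY
    rw [setIntegral_matDot_indicator (hBm t) hY]
    by_cases ht : t = T.root
    · rw [ht, hDroot φ hφ, hBroot, setIntegral_empty]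
    · rw [hBne t ht, (hU t ht).2.1 φ hφ]
  have hHint : ∀ φ ∈ Vset n, ∀ t Y, IntegrableOn (fun x => matDot (H t x) (φ x)) Y := by
    intro φ hφ t Y
    refine integrableOn_matDot_indicator (hBm t) Y ?_
    by_cases ht : t = T.root
    · rw [ht, hBroot]; exact integrableOn_empty
    · rw [hBne t ht]
      exact (continuous_matDot (hU t ht).1 (continuous_of_mem_Vset hφ)).integrableOn_openCube _ _
  set f : Γ → Euc n → Matrix (Fin n) (Fin n) ℝ :=
    fun t => (if t ∈ S then E t else ∅).indicator g with hfdef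
  have hEm' : ∀ t, MeasurableSet (if t ∈ S then E t else ∅) := fun t => by
    split_ifs
    exacts [hEm t, MeasurableSet.empty]
  have hEsub' : ∀ t, (if t ∈ S then E t else ∅) ⊆ extCube wd t := fun t => by
    split_ifs
    exacts [hEsub t, empty_subset _]
  have hfle : ∀ t x, matLinf (f t x) ≤ matLinf (g x) := fun t x => matLinf_indicator_le _ _ _
  have hgt0 : ∀ t, t ∉ A → ∀ x,
      f t x + ∑ c ∈ A with (T.parent c = t ∧ c ≠ T.root), H c x - H t x = 0 := by
    intro t ht x
    have htS : t ∉ S := fun h => ht (hSA t h t (treeLE_refl T t))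
    have hsum : ∑ c ∈ A with (T.parent c = t ∧ c ≠ T.root), H c x = 0 :=
      Finset.sum_eq_zero fun c hc => by
        obtain ⟨hcA, rfl, -⟩ := Finset.mem_filter.1 hc
        obtain ⟨k, hck, hk⟩ := (hA c).1 hcA
        exact absurd ((hA _).2 ⟨k, (treeLE_parent T c).trans hck, hk⟩) ht
    rw [hsum, hHzero t ht]
    simp [hfdef, htS]
  refine ⟨fun t x => f t x + ∑ c ∈ A with (T.parent c = t ∧ c ≠ T.root), H c x - H t x,
    ?_, ?_, ?_, ?_, ?_, hsubfin, ?_⟩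
  · intro x hx
    rw [finsum_eq_sum_of_support_subset (s := A) _ fun t ht => by
      by_contra htA
      exact ht (hgt0 t htA x)]
    have hsum : ∑ t ∈ A, ∑ c ∈ A with (T.parent c = t ∧ c ≠ T.root), H c x = ∑ t ∈ A, H t x := by
      rw [← Finset.sum_filter_of_ne (s := A) (p := (· ≠ T.root)) (f := fun t => H t x)
        (fun t _ hne htr => hne (by simp [hHdef, htr, hBroot])),
        ← Finset.sum_fiberwise_of_maps_to (s := A.filter (· ≠ T.root)) (t := A) (g := T.parent)
          (f := fun t => H t x) ?_]
      · refine Finset.sum_congr rfl fun t _ => ?_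
        rw [Finset.filter_filter]
        simp_rw [and_comm]
      · intro c hc
        obtain ⟨k, hck, hk⟩ := (hA c).1 (Finset.mem_filter.1 hc).1
        exact (hA _).2 ⟨k, (treeLE_parent T c).trans hck, hk⟩
    rw [Finset.sum_sub_distrib, Finset.sum_add_distrib, hsum, add_sub_cancel_right]
    by_cases hgx : g x = 0
    · rw [hgx, Finset.sum_eq_zero fun t _ => ?_]
      exact indicator_apply_eq_zero.2 fun _ => hgx
    · obtain ⟨t, ht, hxt⟩ := hEcov' x hx hgx
      rw [Finset.sum_eq_single_of_mem t (hSA t ht t (treeLE_refl T t))]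
      · simp [hfdef, ht, hxt]
      · intro t' _ hne
        refine indicator_of_notMem (fun hxt' => ?_) _
        split_ifs at hxt' with ht'
        · exact Set.disjoint_left.1 (hEdisj t' ht' t ht hne) hxt' hxt
        · exact hxt'
  · intro t x hx
    by_contra hxt
    refine hx ?_
    have h1 : f t x = 0 := indicator_of_notMem (fun h => hxt (hEsub' t h)) _
    have h2 : H t x = 0 := indicator_of_notMem (fun h => hxt (hBsub t h).1) _
    have h3 : ∑ c ∈ A with (T.parent c = t ∧ c ≠ T.root), H c x = 0 :=
      Finset.sum_eq_zero fun c hc => indicator_of_notMem (fun h => hxt (by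
        obtain ⟨-, rfl, -⟩ := Finset.mem_filter.1 hc
        exact (hBsub c h).2)) _
    simp only [h1, h2, h3, add_zero, sub_zero]
  · intro t φ hφ
    have hfint : IntegrableOn (fun x => matDot (f t x) (φ x)) (extCube wd t) :=
      integrableOn_matDot_indicator (hEm' t) _
        ((hgφ φ hφ).mono_set ((hEsub' t).trans (extCube_subset wd hΩ t)))
    have hfeq : ∫ x in extCube wd t, matDot (f t x) (φ x) =
        if t ∈ S then ∫ x in E t, matDot (g x) (φ x) else 0 := by
      rw [setIntegral_matDot_indicator (hEm' t) (hEsub' t)]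
      split_ifs
      · rfl
      · exact setIntegral_empty
    have hsumint : IntegrableOn (fun x => ∑ c ∈ A with (T.parent c = t ∧ c ≠ T.root),
        matDot (H c x) (φ x)) (extCube wd t) :=
      integrable_finsetSum _ fun c _ => hHint φ hφ c _
    have haddint : IntegrableOn (fun x => matDot (f t x) (φ x) +
        ∑ c ∈ A with (T.parent c = t ∧ c ≠ T.root), matDot (H c x) (φ x)) (extCube wd t) :=
      hfint.add hsumint
    simp_rw [matDot_sub_left, matDot_add_left, matDot_sum_left]
    rw [integral_sub haddint (hHint φ hφ t _), integral_add hfint hsumint,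
      integral_finsetSum _ fun c _ => hHint φ hφ c _, hfeq,
      hHφ φ hφ t _ ((hBsub t).trans inter_subset_left),
      Finset.sum_congr rfl fun c hc => hHφ φ hφ c _ (by
        obtain ⟨-, rfl, -⟩ := Finset.mem_filter.1 hc
        exact (hBsub c).trans inter_subset_right)]
    simp_rw [hDint φ hφ]
    rw [sum_treeLE_eq_add_sum_children T S A hSA (fun s => ∫ x in E s, matDot (g x) (φ x)) t,
      sub_self]
  · rintro t x ⟨s, hs, hx, hst⟩
    rw [hardyT_eq hBdisj _ hs hx]
    have hHs : H s x = U s x := indicator_of_mem (by rwa [hBne s hs]) _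
    have hb := (hU s hs).2.2.2 x hx
    have hC : 0 ≤ CB * 3 ^ n * (1 + 12 * n * (1 + CB)) * K ^ (n + 1) *
        ((∫ y in shadow T s, |matL1 (g y)|) / (volume (shadow T s)).toReal) :=
      (abs_nonneg _).trans (hb ⟨0, hn0⟩ ⟨0, hn0⟩)
    have hps : T.parent s ≠ s := fun h =>
      hs (eq_root_of_treeLE_parent (by rw [h]; exact treeLE_refl T s))
    have hother := hHother s hs x hx
    rcases hst with rfl | rfl
    · have hsum : ∑ c ∈ A with (T.parent c = s ∧ c ≠ T.root), H c x = 0 :=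
        Finset.sum_eq_zero fun c hc => hother c (by
          rintro rfl
          exact hps (Finset.mem_filter.1 hc).2.1)
      simp only [hsum, add_zero, hHs, sub_eq_add_neg]
      exact matLinf_le_add (hfle s x) (fun j k => by simpa using hb j k) hC
    · have hsum : ∑ c ∈ A with (T.parent c = T.parent s ∧ c ≠ T.root), H c x = U s x := by
        rw [← hHs]
        refine Finset.sum_eq_single s (fun c _ hcs => hother c hcs) fun hsA => ?_
        rw [hHzero s fun h => hsA (Finset.mem_filter.2 ⟨h, rfl, hs⟩)]
        rfl
      simp only [hsum, hother _ hps, sub_zero]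
      exact matLinf_le_add (hfle _ x) hb hC
  · intro t x hx
    have hmem : ∀ c, (c = t ∨ T.parent c = t) → H c x = 0 := by
      intro c hc
      refine indicator_of_notMem (fun hxc => ?_) _
      by_cases hcr : c = T.root
      · rw [hcr, hBroot] at hxc; exact hxc
      · rw [hBne c hcr] at hxc
        exact hx ⟨c, hcr, hxc, hc⟩
    have hsum : ∑ c ∈ A with (T.parent c = t ∧ c ≠ T.root), H c x = 0 :=
      Finset.sum_eq_zero fun c hc => hmem c (Or.inr (Finset.mem_filter.1 hc).2.1)
    simp only [hsum, hmem t (Or.inl rfl), add_zero, sub_zero]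
    exact hfle t x
  · intro t ht
    funext x
    exact hgt0 t (fun h => ht ((hA t).1 h)) x

end
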